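/- Let φ be an Orlicz N-function with right derivative p. For every f ∈ Λ_{φ,w}: (i) ‖f‖⁰ = inf_{k>0} (1/k)(1 + ρ_{φ,w}(kf)); and (ii) for every k > 0, k ∈ K(f) if and only if ‖f‖⁰ = (1/k)(1 + ρ_{φ,w}(kf)). -/

import Mathlib

open MeasureTheory Set Filter Topology ENNReal

noncomputable section

namespace OL

/-- The interval `I = [0, γ)` inside `ℝ`, for `γ : ℝ≥0∞`. -/
def II (γ : ℝ≥0∞) : Set ℝ := {t : ℝ | 0 ≤ t ∧ (ENNReal.ofReal t) < γ}

/-- Distribution function of `f` on `I = [0, γ)`. -/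
def df (γ : ℝ≥0∞) (f : ℝ → ℝ) (l : ℝ) : ℝ≥0∞ := volume {s | s ∈ II γ ∧ l < |f s|}

/-- Decreasing rearrangement of `f` on `I = [0, γ)`. -/
def rear (γ : ℝ≥0∞) (f : ℝ → ℝ) (t : ℝ) : ℝ :=
  sInf {l : ℝ | 0 < l ∧ df γ f l ≤ ENNReal.ofReal t}

/-- The modular `ρ_{φ,w}(f) = ∫_I φ(f^*) w`. -/
def rho (γ : ℝ≥0∞) (φ w f : ℝ → ℝ) : ℝ≥0∞ :=
  ∫⁻ t in II γ, ENNReal.ofReal (φ (rear γ f t) * w t)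

/-- Membership in the Orlicz–Lorentz space `Λ_{φ,w}`. -/
def MemL (γ : ℝ≥0∞) (φ w f : ℝ → ℝ) : Prop :=
  Measurable f ∧ ∃ l : ℝ, 0 < l ∧ rho γ φ w (fun t => l * f t) < ⊤

/-- Membership in the order-continuous part `(Λ_{φ,w})_a`. -/
def MemLa (γ : ℝ≥0∞) (φ w f : ℝ → ℝ) : Prop :=
  Measurable f ∧ ∀ l : ℝ, 0 < l → rho γ φ w (fun t => l * f t) < ⊤

/-- The Luxemburg norm on `Λ_{φ,w}`. -/
def lux (γ : ℝ≥0∞) (φ w f : ℝ → ℝ) : ℝ :=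
  sInf {ε : ℝ | 0 < ε ∧ rho γ φ w (fun t => f t / ε) ≤ 1}

/-- The complementary Orlicz function `φ_*(v) = sup{uv - φ(u) : u ≥ 0}`. -/
def conj (φ : ℝ → ℝ) (v : ℝ) : ℝ := sSup {x : ℝ | ∃ u : ℝ, 0 ≤ u ∧ x = u * v - φ u}

/-- The Orlicz norm on `Λ_{φ,w}` (with values in `ℝ≥0∞`):
`‖f‖⁰ = sup{∫_I f^* g^* w : ρ_{φ_*,w}(g) ≤ 1}`. -/
def orl (γ : ℝ≥0∞) (φ w f : ℝ → ℝ) : ℝ≥0∞ :=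
  ⨆ g ∈ {g : ℝ → ℝ | Measurable g ∧ rho γ (conj φ) w g ≤ 1},
    ∫⁻ t in II γ, ENNReal.ofReal (rear γ f t * rear γ g t * w t)

/-- `θ(f) = inf{λ > 0 : ρ_{φ,w}(f/λ) < ∞}`. -/
def theta (γ : ℝ≥0∞) (φ w f : ℝ → ℝ) : ℝ :=
  sInf {l : ℝ | 0 < l ∧ rho γ φ w (fun t => f t / l) < ⊤}

/-- Orlicz function. -/
def IsOrlicz (φ : ℝ → ℝ) : Prop :=
  ConvexOn ℝ (Ici 0) φ ∧ φ 0 = 0 ∧ ∀ t : ℝ, 0 < t → 0 < φ t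

/-- Orlicz `N`-function. -/
def IsN (φ : ℝ → ℝ) : Prop :=
  IsOrlicz φ ∧ Tendsto (fun t => φ t / t) (𝓝[>] (0:ℝ)) (𝓝 0) ∧
    Tendsto (fun t => φ t / t) atTop atTop

/-- `p` is the right derivative of `φ` on `[0,∞)`. -/
def IsRightDeriv (φ p : ℝ → ℝ) : Prop :=
  ∀ u : ℝ, 0 ≤ u → HasDerivWithinAt φ (p u) (Ici u) u

/-- An admissible (decreasing, positive, locally integrable) weight on `[0, γ)`,
with `W(∞) = ∞` when `γ = ∞`. -/
def IsWeight (γ : ℝ≥0∞) (w : ℝ → ℝ) : Prop :=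
  Measurable w ∧ (∀ t ∈ II γ, 0 < w t) ∧
  (∀ s ∈ II γ, ∀ t ∈ II γ, s ≤ t → w t ≤ w s) ∧
  (∀ t ∈ II γ, IntegrableOn w (Icc 0 t) volume) ∧
  (γ = ⊤ → (∫⁻ t in II γ, ENNReal.ofReal (w t)) = ⊤)

/-- `k^*(f)`. -/
def kstar (γ : ℝ≥0∞) (φ w p f : ℝ → ℝ) : ℝ :=
  sInf {k : ℝ | 0 < k ∧ 1 ≤ rho γ (conj φ) w (fun t => p (k * |f t|))}

/-- `k^{**}(f)`. -/
def kstarstar (γ : ℝ≥0∞) (φ w p f : ℝ → ℝ) : ℝ :=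
  sSup {k : ℝ | 0 < k ∧ rho γ (conj φ) w (fun t => p (k * |f t|)) ≤ 1}

/-- Linearity of a functional on the subspace `Λ_{φ,w}`. -/
def IsLin (γ : ℝ≥0∞) (φ w : ℝ → ℝ) (S : (ℝ → ℝ) → ℝ) : Prop :=
  (∀ f g : ℝ → ℝ, MemL γ φ w f → MemL γ φ w g → S (f + g) = S f + S g) ∧
  (∀ (c : ℝ) (f : ℝ → ℝ), MemL γ φ w f → S (c • f) = c * S f)

/-- Boundedness with respect to the Luxemburg norm. -/
def BddLux (γ : ℝ≥0∞) (φ w : ℝ → ℝ) (S : (ℝ → ℝ) → ℝ) : Prop :=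
  ∃ C : ℝ, ∀ f : ℝ → ℝ, MemL γ φ w f → |S f| ≤ C * lux γ φ w f

/-- Boundedness with respect to the Orlicz norm. -/
def BddOrl (γ : ℝ≥0∞) (φ w : ℝ → ℝ) (S : (ℝ → ℝ) → ℝ) : Prop :=
  ∃ C : ℝ, 0 ≤ C ∧ ∀ f : ℝ → ℝ, MemL γ φ w f →
    ENNReal.ofReal |S f| ≤ ENNReal.ofReal C * orl γ φ w f

/-- A singular functional: bounded, linear, vanishing on the order-continuous part. -/
def IsSingular (γ : ℝ≥0∞) (φ w : ℝ → ℝ) (S : (ℝ → ℝ) → ℝ) : Prop :=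
  IsLin γ φ w S ∧ BddLux γ φ w S ∧ ∀ f : ℝ → ℝ, MemLa γ φ w f → S f = 0

/-- Operator norm with respect to the Luxemburg norm. -/
def opLux (γ : ℝ≥0∞) (φ w : ℝ → ℝ) (S : (ℝ → ℝ) → ℝ) : ℝ :=
  sSup {r : ℝ | ∃ f : ℝ → ℝ, MemL γ φ w f ∧ lux γ φ w f ≤ 1 ∧ r = S f}

/-- Operator norm with respect to the Orlicz norm. -/
def opOrl (γ : ℝ≥0∞) (φ w : ℝ → ℝ) (S : (ℝ → ℝ) → ℝ) : ℝ :=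
  sSup {r : ℝ | ∃ f : ℝ → ℝ, MemL γ φ w f ∧ orl γ φ w f ≤ 1 ∧ r = S f}

/-- `v ≺ w` : `∫₀ᵗ v^* ≤ ∫₀ᵗ w` for all `t ∈ I`, with `v` nonnegative and measurable. -/
def Prec (γ : ℝ≥0∞) (w v : ℝ → ℝ) : Prop :=
  Measurable v ∧ (∀ t : ℝ, 0 ≤ v t) ∧
  ∀ t ∈ II γ, (∫⁻ s in Icc (0:ℝ) t, ENNReal.ofReal (rear γ v s)) ≤
    ∫⁻ s in Icc (0:ℝ) t, ENNReal.ofReal (w s)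

/-- The modular `P_{ψ,w}(h) = inf{∫_I ψ(|h|/v) v : v ≥ 0, v ≺ w}`. -/
def P (γ : ℝ≥0∞) (ψ w h : ℝ → ℝ) : ℝ≥0∞ :=
  ⨅ v ∈ {v : ℝ → ℝ | Prec γ w v}, ∫⁻ t in II γ, ENNReal.ofReal (ψ (|h t| / v t) * v t)

/-- Luxemburg norm of the space `M_{ψ,w}` (real-valued). -/
def Mlux (γ : ℝ≥0∞) (ψ w h : ℝ → ℝ) : ℝ :=
  sInf {ε : ℝ | 0 < ε ∧ P γ ψ w (fun t => h t / ε) ≤ 1}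

/-- Luxemburg norm of the space `M_{ψ,w}` (`ℝ≥0∞`-valued; `∞` when `h ∉ M_{ψ,w}`). -/
def MluxE (γ : ℝ≥0∞) (ψ w h : ℝ → ℝ) : ℝ≥0∞ :=
  sInf {e : ℝ≥0∞ | ∃ ε : ℝ, 0 < ε ∧ e = ENNReal.ofReal ε ∧ P γ ψ w (fun t => h t / ε) ≤ 1}

/-- Orlicz norm of the space `M_{ψ,w}`: `inf_{k>0} (1/k)(1 + P_{ψ,w}(kh))`. -/
def Morl (γ : ℝ≥0∞) (ψ w h : ℝ → ℝ) : ℝ≥0∞ :=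
  ⨅ k ∈ Ioi (0:ℝ), (ENNReal.ofReal k)⁻¹ * (1 + P γ ψ w (fun t => k * h t))

/-- The appropriate `Δ₂` condition: `Δ₂` if `γ = ∞`, `Δ₂^∞` if `γ < ∞`. -/
def appDelta2 (γ : ℝ≥0∞) (φ : ℝ → ℝ) : Prop :=
  (γ = ⊤ → ∃ K : ℝ, 0 < K ∧ ∀ u : ℝ, 0 ≤ u → φ (2 * u) ≤ K * φ u) ∧
  (γ ≠ ⊤ → ∃ K u₀ : ℝ, 0 < K ∧ 0 ≤ u₀ ∧ ∀ u : ℝ, u₀ ≤ u → φ (2 * u) ≤ K * φ u)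


lemma tangent {φ p : ℝ → ℝ} (hφ : IsN φ) (hp : IsRightDeriv φ p) {u v : ℝ} (hu : 0 ≤ u)
    (hv : 0 ≤ v) : φ u + p u * (v - u) ≤ φ v := by
  have hc := hφ.1.1
  have ht : Tendsto (slope φ u) (𝓝[>] u) (𝓝 (p u)) := by
    have := (hasDerivWithinAt_iff_tendsto_slope).1 (hp u hu)
    simpa using this
  rcases lt_trichotomy v u with h | h | h
  · have : (φ u - φ v) / (u - v) ≤ p u := by
      refine ge_of_tendsto ht ?_
      filter_upwards [self_mem_nhdsWithin] with z hz
      have hz : u < z := hz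
      have := hc.slope_mono_adjacent (x := v) (y := u) (z := z) hv (hu.trans hz.le) h hz
      rw [slope_def_field]; exact this
    rw [div_le_iff₀ (by linarith)] at this
    nlinarith
  · subst h; simp
  · have : p u ≤ (φ v - φ u) / (v - u) := by
      refine le_of_tendsto ht ?_
      have : Ioo u v ∈ 𝓝[>] u := Ioo_mem_nhdsGT h
      filter_upwards [this] with z hz
      have := hc.secant_mono (a := u) (x := z) (y := v) hu (hu.trans hz.1.le) hv
        hz.1.ne' h.ne' hz.2.le
      rw [slope_def_field]; exact this
    rw [le_div_iff₀ (by linarith)] at this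
    nlinarith

lemma p_pos {φ p : ℝ → ℝ} (hφ : IsN φ) (hp : IsRightDeriv φ p) {u : ℝ} (hu : 0 < u) :
    0 < p u := by
  have h := tangent hφ hp hu.le (le_refl 0)
  have h1 := hφ.1.2.2 u hu
  rw [hφ.1.2.1] at h
  by_contra! h2
  nlinarith

lemma p_zero {φ p : ℝ → ℝ} (hφ : IsN φ) (hp : IsRightDeriv φ p) : p 0 = 0 := by
  have ht : Tendsto (slope φ 0) (𝓝[>] 0) (𝓝 (p 0)) := by
    have := (hasDerivWithinAt_iff_tendsto_slope).1 (hp 0 le_rfl)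
    simpa using this
  refine tendsto_nhds_unique ht ?_
  refine hφ.2.1.congr ?_
  intro t
  rw [slope_def_field, hφ.1.2.1]; simp

lemma p_mono {φ p : ℝ → ℝ} (hφ : IsN φ) (hp : IsRightDeriv φ p) {u v : ℝ} (hu : 0 ≤ u)
    (h : u ≤ v) : p u ≤ p v := by
  rcases h.eq_or_lt with h | h
  · rw [h]
  have h1 := tangent hφ hp hu (hu.trans h.le)
  have h2 := tangent hφ hp (hu.trans h.le) hu
  by_contra! h3
  nlinarith

lemma p_nonneg {φ p : ℝ → ℝ} (hφ : IsN φ) (hp : IsRightDeriv φ p) {u : ℝ} (hu : 0 ≤ u) :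
    0 ≤ p u := by
  rw [← p_zero hφ hp]; exact p_mono hφ hp le_rfl hu

lemma phi_mono {φ p : ℝ → ℝ} (hφ : IsN φ) (hp : IsRightDeriv φ p) {u v : ℝ} (hu : 0 ≤ u)
    (h : u ≤ v) : φ u ≤ φ v := by
  have h1 := tangent hφ hp hu (hu.trans h)
  have := p_nonneg hφ hp hu
  nlinarith

lemma phi_nonneg {φ : ℝ → ℝ} (hφ : IsN φ) {u : ℝ} (hu : 0 ≤ u) : 0 ≤ φ u := by
  rcases hu.eq_or_lt with h | h
  · rw [← h, hφ.1.2.1]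
  · exact (hφ.1.2.2 u h).le

lemma p_top {φ p : ℝ → ℝ} (hφ : IsN φ) (hp : IsRightDeriv φ p) (M : ℝ) :
    ∃ u, 0 < u ∧ M < p u := by
  have h := (hφ.2.2.eventually_gt_atTop M).and (eventually_gt_atTop 0)
  obtain ⟨u, h1, h2⟩ := h.exists
  refine ⟨u, h2, h1.trans_le ?_⟩
  have h := tangent hφ hp h2.le (le_refl 0)
  rw [hφ.1.2.1] at h
  rw [div_le_iff₀ h2]; linarith

lemma p_small {φ p : ℝ → ℝ} (hφ : IsN φ) (hp : IsRightDeriv φ p) {M : ℝ} (hM : 0 < M) :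
    ∃ u, 0 < u ∧ p u < M := by
  have h := (hφ.2.1.eventually_lt_const (by positivity : (0:ℝ) < M / 2)).and self_mem_nhdsWithin
  obtain ⟨u, h1, h2⟩ := h.exists
  have h2 : 0 < u := h2
  refine ⟨u / 2, by positivity, ?_⟩
  have h := tangent hφ hp (by positivity : 0 ≤ u / 2) h2.le
  have := phi_nonneg hφ (by positivity : 0 ≤ u / 2)
  rw [div_lt_iff₀ h2] at h1
  nlinarith

lemma conj_bdd {φ : ℝ → ℝ} (hφ : IsN φ) (v : ℝ) :
    BddAbove {x : ℝ | ∃ u : ℝ, 0 ≤ u ∧ x = u * v - φ u} := by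
  obtain ⟨M, hM⟩ := ((hφ.2.2.eventually_ge_atTop v).and (eventually_gt_atTop 0)).exists_forall_of_atTop
  refine ⟨max 0 (M * |v|), ?_⟩
  rintro x ⟨u, hu, rfl⟩
  have hM0 : 0 < M := (hM M le_rfl).2
  rcases le_total M u with h | h
  · obtain ⟨h1, h2⟩ := hM u h
    rw [le_div_iff₀ h2] at h1
    exact le_max_of_le_left (by linarith)
  · refine le_max_of_le_right ?_
    have := phi_nonneg hφ hu
    have h3 : u * v ≤ u * |v| := mul_le_mul_of_nonneg_left (le_abs_self v) hu
    have h4 : u * |v| ≤ M * |v| := mul_le_mul_of_nonneg_right h (abs_nonneg v)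
    linarith

lemma young {φ : ℝ → ℝ} (hφ : IsN φ) {u : ℝ} (hu : 0 ≤ u) (v : ℝ) :
    u * v ≤ φ u + conj φ v := by
  have := le_csSup (conj_bdd hφ v) ⟨u, hu, rfl⟩
  unfold conj; linarith

lemma conj_nonneg {φ : ℝ → ℝ} (hφ : IsN φ) (v : ℝ) : 0 ≤ conj φ v := by
  have := young hφ le_rfl v
  rw [hφ.1.2.1] at this; simpa using this

lemma conj_mono {φ : ℝ → ℝ} (hφ : IsN φ) {u v : ℝ} (h : u ≤ v) : conj φ u ≤ conj φ v := by
  refine csSup_le ⟨_, 0, le_rfl, rfl⟩ ?_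
  rintro x ⟨z, hz, rfl⟩
  have := young hφ hz v
  have := mul_le_mul_of_nonneg_left h hz
  linarith

lemma conj_p {φ p : ℝ → ℝ} (hφ : IsN φ) (hp : IsRightDeriv φ p) {u : ℝ} (hu : 0 ≤ u) :
    conj φ (p u) = u * p u - φ u := by
  apply le_antisymm
  · refine csSup_le ⟨_, 0, le_rfl, rfl⟩ ?_
    rintro x ⟨z, hz, rfl⟩
    have := tangent hφ hp hu hz
    nlinarith
  · have := young hφ hu (p u); linarith

/-- pointwise lower increment -/
lemma incr_low {φ p : ℝ → ℝ} (hφ : IsN φ) (hp : IsRightDeriv φ p) {a b u : ℝ} (ha : 0 < a)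
    (hab : a ≤ b) (hu : 0 ≤ u) :
    b * φ (a * u) + (b - a) * conj φ (p (a * u)) ≤ a * φ (b * u) := by
  have hb : 0 < b := by linarith
  rw [conj_p hφ hp (by positivity)]
  have := tangent hφ hp (u := a * u) (v := b * u) (by positivity) (by positivity)
  nlinarith

lemma incr_up {φ p : ℝ → ℝ} (hφ : IsN φ) (hp : IsRightDeriv φ p) {a b u : ℝ} (ha : 0 < a)
    (hab : a ≤ b) (hu : 0 ≤ u) :
    a * φ (b * u) ≤ b * φ (a * u) + (b - a) * conj φ (p (b * u)) := by
  have hb : 0 < b := by linarith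
  rw [conj_p hφ hp (by positivity)]
  have := tangent hφ hp (u := b * u) (v := a * u) (by positivity) (by positivity)
  nlinarith

lemma conj_p_top {φ p : ℝ → ℝ} (hφ : IsN φ) (hp : IsRightDeriv φ p) (M : ℝ) :
    ∃ u, 0 < u ∧ M < conj φ (p u) := by
  obtain ⟨u, hu, h⟩ := p_top hφ hp (M + φ 1)
  refine ⟨u, hu, ?_⟩
  have := young hφ zero_le_one (p u)
  linarith

lemma conj_p_mono {φ p : ℝ → ℝ} (hφ : IsN φ) (hp : IsRightDeriv φ p) {u v : ℝ} (hu : 0 ≤ u)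
    (h : u ≤ v) : conj φ (p u) ≤ conj φ (p v) := conj_mono hφ (p_mono hφ hp hu h)

lemma meas_of_mono {h V : ℝ → ℝ} (hh : ∀ u v, 0 ≤ u → u ≤ v → h u ≤ h v) (hV : Measurable V)
    (hV0 : ∀ t, 0 ≤ V t) : Measurable (fun t => h (V t)) := by
  have : Monotone (fun x => h (max x 0)) := fun x y hxy =>
    hh _ _ (le_max_right _ _) (max_le_max hxy le_rfl)
  have h2 := this.measurable.comp hV
  have h3 : (fun t => h (V t)) = (fun x => h (max x 0)) ∘ V := by
    funext t; simp [hV0 t]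
  rw [h3]; exact h2

def RR (μ : Measure ℝ) (φ V : ℝ → ℝ) (k : ℝ) : ℝ≥0∞ := ∫⁻ t, ENNReal.ofReal (φ (k * V t)) ∂μ

def AA (μ : Measure ℝ) (φ p V : ℝ → ℝ) (k : ℝ) : ℝ≥0∞ :=
  ∫⁻ t, ENNReal.ofReal (conj φ (p (k * V t))) ∂μ

def FF (μ : Measure ℝ) (φ V : ℝ → ℝ) (k : ℝ) : ℝ≥0∞ :=
  (ENNReal.ofReal k)⁻¹ * (1 + RR μ φ V k)

section abs
variable {μ : Measure ℝ} {φ p V : ℝ → ℝ}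

lemma meas_phi (hφ : IsN φ) (hp : IsRightDeriv φ p) (hV : Measurable V) (hV0 : ∀ t, 0 ≤ V t) :
    Measurable (fun t => φ (V t)) :=
  meas_of_mono (fun _ _ hu h => phi_mono hφ hp hu h) hV hV0

lemma meas_q (hφ : IsN φ) (hp : IsRightDeriv φ p) (hV : Measurable V) (hV0 : ∀ t, 0 ≤ V t) :
    Measurable (fun t => conj φ (p (V t))) :=
  meas_of_mono (h := fun u => conj φ (p u)) (fun _ _ hu h => conj_p_mono hφ hp hu h) hV hV0

lemma RR_mono (hφ : IsN φ) (hp : IsRightDeriv φ p) (hV0 : ∀ t, 0 ≤ V t) {a b : ℝ} (ha : 0 ≤ a)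
    (hab : a ≤ b) : RR μ φ V a ≤ RR μ φ V b :=
  lintegral_mono fun t => ENNReal.ofReal_le_ofReal
    (phi_mono hφ hp (mul_nonneg ha (hV0 t)) (mul_le_mul_of_nonneg_right hab (hV0 t)))

lemma AA_mono (hφ : IsN φ) (hp : IsRightDeriv φ p) (hV0 : ∀ t, 0 ≤ V t) {a b : ℝ} (ha : 0 ≤ a)
    (hab : a ≤ b) : AA μ φ p V a ≤ AA μ φ p V b :=
  lintegral_mono fun t => ENNReal.ofReal_le_ofReal
    (conj_p_mono hφ hp (mul_nonneg ha (hV0 t)) (mul_le_mul_of_nonneg_right hab (hV0 t)))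

lemma low (hφ : IsN φ) (hp : IsRightDeriv φ p) (hV : Measurable V) (hV0 : ∀ t, 0 ≤ V t)
    {a b : ℝ} (ha : 0 < a) (hab : a ≤ b) :
    ENNReal.ofReal b * RR μ φ V a + ENNReal.ofReal (b - a) * AA μ φ p V a
      ≤ ENNReal.ofReal a * RR μ φ V b := by
  have hb : 0 < b := by linarith
  have m1 : ∀ c : ℝ, 0 < c → Measurable (fun t => φ (c * V t)) := fun c hc =>
    meas_phi hφ hp (hV.const_mul c) (fun t => mul_nonneg hc.le (hV0 t))
  have m2 : ∀ c : ℝ, 0 < c → Measurable (fun t => conj φ (p (c * V t))) := fun c hc =>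
    meas_q hφ hp (hV.const_mul c) (fun t => mul_nonneg hc.le (hV0 t))
  unfold RR AA
  rw [← lintegral_const_mul _ (m1 a ha).ennreal_ofReal,
    ← lintegral_const_mul _ (m2 a ha).ennreal_ofReal,
    ← lintegral_const_mul _ (m1 b hb).ennreal_ofReal,
    ← lintegral_add_left ((m1 a ha).ennreal_ofReal.const_mul _)]
  refine lintegral_mono fun t => ?_
  have hpa := phi_nonneg hφ (mul_nonneg ha.le (hV0 t))
  have hqa := conj_nonneg hφ (p (a * V t))
  have hba : 0 ≤ b - a := by linarith
  rw [← ENNReal.ofReal_mul hb.le, ← ENNReal.ofReal_mul hba, ← ENNReal.ofReal_mul ha.le,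
    ← ENNReal.ofReal_add (by positivity) (by positivity)]
  exact ENNReal.ofReal_le_ofReal (incr_low hφ hp ha hab (hV0 t))

lemma up (hφ : IsN φ) (hp : IsRightDeriv φ p) (hV : Measurable V) (hV0 : ∀ t, 0 ≤ V t)
    {a b : ℝ} (ha : 0 < a) (hab : a ≤ b) :
    ENNReal.ofReal a * RR μ φ V b ≤
    ENNReal.ofReal b * RR μ φ V a + ENNReal.ofReal (b - a) * AA μ φ p V b := by
  have hb : 0 < b := by linarith
  have m1 : ∀ c : ℝ, 0 < c → Measurable (fun t => φ (c * V t)) := fun c hc =>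
    meas_phi hφ hp (hV.const_mul c) (fun t => mul_nonneg hc.le (hV0 t))
  have m2 : ∀ c : ℝ, 0 < c → Measurable (fun t => conj φ (p (c * V t))) := fun c hc =>
    meas_q hφ hp (hV.const_mul c) (fun t => mul_nonneg hc.le (hV0 t))
  unfold RR AA
  rw [← lintegral_const_mul _ (m1 a ha).ennreal_ofReal,
    ← lintegral_const_mul _ (m2 b hb).ennreal_ofReal,
    ← lintegral_const_mul _ (m1 b hb).ennreal_ofReal,
    ← lintegral_add_left ((m1 a ha).ennreal_ofReal.const_mul _)]
  refine lintegral_mono fun t => ?_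
  have hpa := phi_nonneg hφ (mul_nonneg ha.le (hV0 t))
  have hqa := conj_nonneg hφ (p (b * V t))
  have hba : 0 ≤ b - a := by linarith
  rw [← ENNReal.ofReal_mul hb.le, ← ENNReal.ofReal_mul hba, ← ENNReal.ofReal_mul ha.le,
    ← ENNReal.ofReal_add (by positivity) (by positivity)]
  exact ENNReal.ofReal_le_ofReal (incr_up hφ hp ha hab (hV0 t))

lemma FF_le_iff {a b : ℝ} (ha : 0 < a) (hb : 0 < b) :
    FF μ φ V a ≤ FF μ φ V b ↔
      ENNReal.ofReal b * (1 + RR μ φ V a) ≤ ENNReal.ofReal a * (1 + RR μ φ V b) := by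
  unfold FF
  have ha' : ENNReal.ofReal a ≠ 0 := by simpa using ha
  have hb' : ENNReal.ofReal b ≠ 0 := by simpa using hb
  rw [mul_comm, ← div_eq_mul_inv, ENNReal.div_le_iff ha' ENNReal.ofReal_ne_top,
    mul_assoc, mul_comm (ENNReal.ofReal b)⁻¹, ← div_eq_mul_inv,
    ENNReal.le_div_iff_mul_le (Or.inl hb') (Or.inl ENNReal.ofReal_ne_top), mul_comm,
    mul_comm (ENNReal.ofReal a)]

lemma FF_le_right (hφ : IsN φ) (hp : IsRightDeriv φ p) (hV : Measurable V) (hV0 : ∀ t, 0 ≤ V t)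
    {a b : ℝ} (ha : 0 < a) (hab : a ≤ b) (hA : 1 ≤ AA μ φ p V a) :
    FF μ φ V a ≤ FF μ φ V b := by
  rw [FF_le_iff ha (ha.trans_le hab)]
  have h := low (μ := μ) hφ hp hV hV0 ha hab
  have hb : ENNReal.ofReal b = ENNReal.ofReal a + ENNReal.ofReal (b - a) := by
    rw [← ENNReal.ofReal_add ha.le (by linarith)]; congr 1; ring
  calc ENNReal.ofReal b * (1 + RR μ φ V a)
      = ENNReal.ofReal a + (ENNReal.ofReal b * RR μ φ V a + ENNReal.ofReal (b - a) * 1) := by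
        rw [mul_add, mul_one, mul_one]; nth_rewrite 1 [hb]; ring
    _ ≤ ENNReal.ofReal a + (ENNReal.ofReal b * RR μ φ V a
          + ENNReal.ofReal (b - a) * AA μ φ p V a) := by gcongr
    _ ≤ ENNReal.ofReal a + ENNReal.ofReal a * RR μ φ V b := by gcongr
    _ = _ := by ring

lemma FF_lt_right (hφ : IsN φ) (hp : IsRightDeriv φ p) (hV : Measurable V) (hV0 : ∀ t, 0 ≤ V t)
    {a b : ℝ} (ha : 0 < a) (hab : a < b) (hA : 1 < AA μ φ p V a) (hR : RR μ φ V a ≠ ⊤) :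
    FF μ φ V a < FF μ φ V b := by
  rw [← not_le, FF_le_iff (ha.trans hab) ha, not_le]
  have h := low (μ := μ) hφ hp hV hV0 ha hab.le
  have hb : ENNReal.ofReal b = ENNReal.ofReal a + ENNReal.ofReal (b - a) := by
    rw [← ENNReal.ofReal_add ha.le (by linarith)]; congr 1; ring
  have hba : ENNReal.ofReal (b - a) ≠ 0 := by simpa using hab
  calc ENNReal.ofReal b * (1 + RR μ φ V a)
      = (ENNReal.ofReal a + ENNReal.ofReal b * RR μ φ V a) + ENNReal.ofReal (b - a) * 1 := by
        rw [mul_add, mul_one, mul_one]; nth_rewrite 1 [hb]; ring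
    _ < (ENNReal.ofReal a + ENNReal.ofReal b * RR μ φ V a)
          + ENNReal.ofReal (b - a) * AA μ φ p V a := by
        refine ENNReal.add_lt_add_left ?_ ?_
        · exact ENNReal.add_ne_top.2 ⟨ENNReal.ofReal_ne_top,
            ENNReal.mul_ne_top ENNReal.ofReal_ne_top hR⟩
        · exact (ENNReal.mul_lt_mul_iff_right hba ENNReal.ofReal_ne_top).2 hA
    _ = ENNReal.ofReal a + (ENNReal.ofReal b * RR μ φ V a
          + ENNReal.ofReal (b - a) * AA μ φ p V a) := by ring
    _ ≤ ENNReal.ofReal a + ENNReal.ofReal a * RR μ φ V b := by gcongr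
    _ = _ := by ring

lemma FF_le_left (hφ : IsN φ) (hp : IsRightDeriv φ p) (hV : Measurable V) (hV0 : ∀ t, 0 ≤ V t)
    {a b : ℝ} (ha : 0 < a) (hab : a ≤ b) (hA : AA μ φ p V b ≤ 1) :
    FF μ φ V b ≤ FF μ φ V a := by
  rw [FF_le_iff (ha.trans_le hab) ha]
  have h := up (μ := μ) hφ hp hV hV0 ha hab
  have hb : ENNReal.ofReal b = ENNReal.ofReal a + ENNReal.ofReal (b - a) := by
    rw [← ENNReal.ofReal_add ha.le (by linarith)]; congr 1; ring
  calc ENNReal.ofReal a * (1 + RR μ φ V b) = ENNReal.ofReal a + ENNReal.ofReal a * RR μ φ V b := by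
        ring
    _ ≤ ENNReal.ofReal a + (ENNReal.ofReal b * RR μ φ V a
          + ENNReal.ofReal (b - a) * AA μ φ p V b) := by gcongr
    _ ≤ ENNReal.ofReal a + (ENNReal.ofReal b * RR μ φ V a + ENNReal.ofReal (b - a) * 1) := by
        gcongr
    _ = ENNReal.ofReal b * (1 + RR μ φ V a) := by
        rw [mul_add, mul_one, mul_one]; nth_rewrite 2 [hb]; ring

lemma FF_lt_left (hφ : IsN φ) (hp : IsRightDeriv φ p) (hV : Measurable V) (hV0 : ∀ t, 0 ≤ V t)
    {a b : ℝ} (ha : 0 < a) (hab : a < b) (hA : AA μ φ p V b < 1) (hR : RR μ φ V a ≠ ⊤) :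
    FF μ φ V b < FF μ φ V a := by
  rw [← not_le, FF_le_iff ha (ha.trans hab), not_le]
  have h := up (μ := μ) hφ hp hV hV0 ha hab.le
  have hb : ENNReal.ofReal b = ENNReal.ofReal a + ENNReal.ofReal (b - a) := by
    rw [← ENNReal.ofReal_add ha.le (by linarith)]; congr 1; ring
  have hba : ENNReal.ofReal (b - a) ≠ 0 := by simpa using hab
  calc ENNReal.ofReal a * (1 + RR μ φ V b) = ENNReal.ofReal a + ENNReal.ofReal a * RR μ φ V b := by
        ring
    _ ≤ ENNReal.ofReal a + (ENNReal.ofReal b * RR μ φ V a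
          + ENNReal.ofReal (b - a) * AA μ φ p V b) := by gcongr
    _ = (ENNReal.ofReal a + ENNReal.ofReal b * RR μ φ V a)
          + ENNReal.ofReal (b - a) * AA μ φ p V b := by ring
    _ < (ENNReal.ofReal a + ENNReal.ofReal b * RR μ φ V a)
          + ENNReal.ofReal (b - a) * 1 := by
        refine ENNReal.add_lt_add_left ?_ ?_
        · exact ENNReal.add_ne_top.2 ⟨ENNReal.ofReal_ne_top,
            ENNReal.mul_ne_top ENNReal.ofReal_ne_top hR⟩
        · exact (ENNReal.mul_lt_mul_iff_right hba ENNReal.ofReal_ne_top).2 hA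
    _ = ENNReal.ofReal b * (1 + RR μ φ V a) := by
        rw [mul_add, mul_one, mul_one]; nth_rewrite 2 [hb]; ring

lemma lim_right (hφ : IsN φ) (hp : IsRightDeriv φ p) (hV0 : ∀ t, 0 ≤ V t)
    {k b : ℝ} (hk : 0 < k) (hb : k < b) {c : ℝ≥0∞} (h : ∀ s, k < s → s < b → FF μ φ V s ≤ c) :
    FF μ φ V k ≤ c := by
  have hk' : ENNReal.ofReal k ≠ 0 := by simpa using hk
  have : Tendsto (fun s => (ENNReal.ofReal s)⁻¹ * (1 + RR μ φ V k)) (𝓝[>] k)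
      (𝓝 (FF μ φ V k)) := by
    refine ENNReal.Tendsto.mul_const ?_ (Or.inl (ENNReal.inv_ne_zero.2 ENNReal.ofReal_ne_top))
    have : Continuous (fun s => (ENNReal.ofReal s)⁻¹) := continuous_inv.comp ENNReal.continuous_ofReal
    exact (this.tendsto k).mono_left nhdsWithin_le_nhds
  refine le_of_tendsto this ?_
  filter_upwards [Ioo_mem_nhdsGT hb] with s hs
  refine le_trans ?_ (h s hs.1 hs.2)
  unfold FF
  gcongr
  exact RR_mono hφ hp hV0 hk.le hs.1.le

lemma lim_left (hφ : IsN φ) (hp : IsRightDeriv φ p) (hV : Measurable V) (hV0 : ∀ t, 0 ≤ V t)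
    {k a : ℝ} (ha : 0 < a) (hak : a < k) {c : ℝ≥0∞} (h : ∀ s, a < s → s < k → FF μ φ V s ≤ c) :
    FF μ φ V k ≤ c := by
  have hk : 0 < k := ha.trans hak
  obtain ⟨u, hu1, hu2, hu3⟩ := exists_seq_strictMono_tendsto' hak
  have hk' : ENNReal.ofReal k ≠ 0 := by simpa using hk
  have h1 : Tendsto (fun n => RR μ φ V (u n)) atTop (𝓝 (RR μ φ V k)) := by
    refine lintegral_tendsto_of_tendsto_of_monotone (fun n => ?_) ?_ ?_
    · exact (meas_phi hφ hp (hV.const_mul _) (fun t => mul_nonneg (ha.trans (hu2 n).1).le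
        (hV0 t))).ennreal_ofReal.aemeasurable
    · refine ae_of_all _ fun t m n hmn => ENNReal.ofReal_le_ofReal ?_
      exact phi_mono hφ hp (mul_nonneg (ha.trans (hu2 m).1).le (hV0 t))
        (mul_le_mul_of_nonneg_right (hu1.monotone hmn) (hV0 t))
    · refine ae_of_all _ fun t => ENNReal.tendsto_ofReal ?_
      have hlow : ∀ n, φ (k * V t) + p (k * V t) * (u n * V t - k * V t) ≤ φ (u n * V t) :=
        fun n => tangent hφ hp (mul_nonneg hk.le (hV0 t)) (mul_nonneg (ha.trans (hu2 n).1).le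
          (hV0 t))
      have hup : ∀ n, φ (u n * V t) ≤ φ (k * V t) := fun n =>
        phi_mono hφ hp (mul_nonneg (ha.trans (hu2 n).1).le (hV0 t))
          (mul_le_mul_of_nonneg_right (hu2 n).2.le (hV0 t))
      refine tendsto_of_tendsto_of_tendsto_of_le_of_le ?_ tendsto_const_nhds hlow hup
      have : Tendsto (fun n => φ (k * V t) + p (k * V t) * (u n * V t - k * V t)) atTop
          (𝓝 (φ (k * V t) + p (k * V t) * (k * V t - k * V t))) :=
        (((hu3.mul_const _).sub_const _).const_mul _).const_add _
      simpa using this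
  have h2 : Tendsto (fun n => (ENNReal.ofReal k)⁻¹ * (1 + RR μ φ V (u n))) atTop
      (𝓝 (FF μ φ V k)) :=
    ENNReal.Tendsto.const_mul (h1.const_add 1) (Or.inr (ENNReal.inv_ne_top.2 hk'))
  refine le_of_tendsto h2 (Eventually.of_forall fun n => ?_)
  refine le_trans ?_ (h _ (hu2 n).1 (hu2 n).2)
  unfold FF
  gcongr
  exact (hu2 n).2.le

lemma exists_small (hφ : IsN φ) (hp : IsRightDeriv φ p) (hV : Measurable V) (hV0 : ∀ t, 0 ≤ V t)
    {l : ℝ} (hl : 0 < l) (hR : RR μ φ V l ≠ ⊤) : ∃ k, 0 < k ∧ AA μ φ p V k ≤ 1 := by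
  set r := (RR μ φ V l).toReal with hr
  have hr0 : 0 ≤ r := ENNReal.toReal_nonneg
  have hk : 0 < l / (2 * (r + 1)) := by positivity
  refine ⟨l / (2 * (r + 1)), hk, ?_⟩
  set k := l / (2 * (r + 1)) with hkd
  have e : k * (2 * (r + 1)) = l := by rw [hkd]; field_simp
  have hkl : k ≤ l / 2 := by nlinarith
  have h := low (μ := μ) hφ hp hV hV0 hk (by linarith : k ≤ l)
  have h1 : ENNReal.ofReal (l / 2) * AA μ φ p V k ≤ ENNReal.ofReal (l / 2) * 1 := by
    calc ENNReal.ofReal (l / 2) * AA μ φ p V k ≤ ENNReal.ofReal (l - k) * AA μ φ p V k := by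
          gcongr; linarith
      _ ≤ _ := le_add_self
      _ ≤ ENNReal.ofReal k * RR μ φ V l := h
      _ = ENNReal.ofReal k * ENNReal.ofReal r := by rw [hr, ENNReal.ofReal_toReal hR]
      _ = ENNReal.ofReal (k * r) := (ENNReal.ofReal_mul hk.le).symm
      _ ≤ ENNReal.ofReal (l / 2) := ENNReal.ofReal_le_ofReal (by nlinarith)
      _ = _ := (mul_one _).symm
  exact (ENNReal.mul_le_mul_iff_right (by simpa using hl) ENNReal.ofReal_ne_top).1 h1

lemma exists_large (hφ : IsN φ) (hp : IsRightDeriv φ p) (hV : Measurable V) (hV0 : ∀ t, 0 ≤ V t)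
    (hne : ¬ ∀ᵐ t ∂μ, V t = 0) : ∃ k, 0 < k ∧ 1 < AA μ φ p V k := by
  by_contra! hcon
  apply hne
  have hmono : Monotone (fun (n : ℕ) t => ENNReal.ofReal (conj φ (p (n * V t)))) := by
    intro m n hmn t
    refine ENNReal.ofReal_le_ofReal (conj_p_mono hφ hp (mul_nonneg (by positivity) (hV0 t)) ?_)
    exact mul_le_mul_of_nonneg_right (by exact_mod_cast hmn) (hV0 t)
  have hm : ∀ n : ℕ, Measurable (fun t => ENNReal.ofReal (conj φ (p (n * V t)))) := fun n =>
    (meas_q hφ hp (hV.const_mul _) (fun t => mul_nonneg (by positivity) (hV0 t))).ennreal_ofReal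
  have h1 : ∫⁻ t, ⨆ n : ℕ, ENNReal.ofReal (conj φ (p (n * V t))) ∂μ ≤ 1 := by
    rw [lintegral_iSup hm hmono]
    refine iSup_le fun n => ?_
    refine le_trans (AA_mono (b := n + 1) hφ hp hV0 (by positivity) (by linarith)) (hcon _ (by positivity))
  filter_upwards [ae_lt_top (Measurable.iSup hm) (ne_top_of_le_ne_top one_ne_top h1)] with t ht
  by_contra hVt
  have hVt : 0 < V t := lt_of_le_of_ne (hV0 t) (Ne.symm hVt)
  refine ht.ne ?_
  rw [iSup_eq_top]
  intro b hb
  obtain ⟨u, hu, h⟩ := conj_p_top hφ hp b.toReal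
  obtain ⟨n, hn⟩ := exists_nat_ge (u / V t)
  refine ⟨n, ?_⟩
  rw [← ENNReal.ofReal_toReal hb.ne]
  refine (ENNReal.ofReal_lt_ofReal_iff_of_nonneg ENNReal.toReal_nonneg).2 (h.trans_le ?_)
  rw [div_le_iff₀ hVt] at hn
  exact conj_p_mono hφ hp hu.le hn

end abs

section abs2
variable {μ : Measure ℝ} {φ p V : ℝ → ℝ}

lemma FF_pos (k : ℝ) : FF μ φ V k ≠ 0 := by
  unfold FF
  refine mul_ne_zero (ENNReal.inv_ne_zero.2 ENNReal.ofReal_ne_top) ?_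
  simp

lemma RR_triv (hφ : IsN φ) (h0 : ∀ᵐ t ∂μ, V t = 0) (k : ℝ) : RR μ φ V k = 0 := by
  unfold RR
  rw [lintegral_congr_ae (g := fun _ => 0)]
  · simp
  · filter_upwards [h0] with t ht
    simp [ht, hφ.1.2.1]

lemma AA_triv (hφ : IsN φ) (hp : IsRightDeriv φ p) (h0 : ∀ᵐ t ∂μ, V t = 0) (k : ℝ) :
    AA μ φ p V k = 0 := by
  unfold AA
  rw [lintegral_congr_ae (g := fun _ => 0)]
  · simp
  · filter_upwards [h0] with t ht
    simp [ht, conj_p hφ hp le_rfl, hφ.1.2.1]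

lemma inf_triv (hφ : IsN φ) (h0 : ∀ᵐ t ∂μ, V t = 0) : ⨅ k ∈ Ioi (0:ℝ), FF μ φ V k = 0 := by
  refine le_antisymm ?_ bot_le
  refine ENNReal.le_of_forall_pos_le_add fun ε hε _ => ?_
  refine (iInf₂_le (ε : ℝ)⁻¹ (by simpa using hε)).trans ?_
  unfold FF
  rw [RR_triv hφ h0, ENNReal.ofReal_inv_of_pos (by simpa using hε)]
  simp

lemma FF_ne_top_iff {k : ℝ} (hk : 0 < k) : FF μ φ V k ≠ ⊤ ↔ RR μ φ V k ≠ ⊤ := by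
  have hk' : ENNReal.ofReal k ≠ 0 := by simpa using hk
  unfold FF
  constructor
  · intro h h1
    apply h
    rw [h1]; simp
  · intro h
    exact ENNReal.mul_ne_top (ENNReal.inv_ne_top.2 hk') (by simp [h])

lemma minim (hφ : IsN φ) (hp : IsRightDeriv φ p) (hV : Measurable V) (hV0 : ∀ t, 0 ≤ V t)
    {l : ℝ} (hl : 0 < l) (hR : RR μ φ V l ≠ ⊤) (A' : ℝ → ℝ≥0∞)
    (h1 : ∀ a b, 0 < a → a < b → AA μ φ p V a ≤ A' b)
    (h2 : ∀ a b, 0 < a → a < b → A' a ≤ AA μ φ p V b) {k : ℝ} (hk : 0 < k) :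
    k ∈ Icc (sInf {k : ℝ | 0 < k ∧ 1 ≤ A' k}) (sSup {k : ℝ | 0 < k ∧ A' k ≤ 1}) ↔
      (⨅ k ∈ Ioi (0:ℝ), FF μ φ V k) = FF μ φ V k := by
  by_cases h0 : ∀ᵐ t ∂μ, V t = 0
  · have hA : ∀ k, 0 < k → A' k = 0 := fun k hk => by
      have := h2 k (k + 1) hk (by linarith)
      rw [AA_triv hφ hp h0] at this
      exact le_antisymm this bot_le
    constructor
    · rintro ⟨_, h⟩
      exfalso
      have : sSup {k : ℝ | 0 < k ∧ A' k ≤ 1} = 0 := by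
        apply Real.sSup_of_not_bddAbove
        rintro ⟨M, hM⟩
        have hpos : 0 < max M 0 + 1 := by positivity
        have := hM (a := max M 0 + 1) ⟨hpos, by rw [hA _ hpos]; exact zero_le_one⟩
        have := le_max_left M 0
        linarith
      linarith
    · rw [inf_triv hφ h0]
      intro h; exact absurd h.symm (FF_pos k)
  obtain ⟨K, hK, hK1⟩ := exists_large hφ hp hV hV0 h0
  have hbdd : BddAbove {k : ℝ | 0 < k ∧ A' k ≤ 1} := by
    refine ⟨K, ?_⟩
    rintro j ⟨hj, hj1⟩
    by_contra! hlt
    exact absurd ((h1 K j hK hlt).trans hj1) (not_le.2 hK1)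
  have hne : {k : ℝ | 0 < k ∧ 1 ≤ A' k}.Nonempty :=
    ⟨K + 1, by positivity, hK1.le.trans (h1 K (K + 1) hK (by linarith))⟩
  have hbd0 : BddBelow {k : ℝ | 0 < k ∧ 1 ≤ A' k} := ⟨0, fun x hx => hx.1.le⟩
  constructor
  · rintro ⟨hk1, hk2⟩
    refine le_antisymm (iInf₂_le k hk) (le_iInf₂ fun b hb => ?_)
    have hb : 0 < b := hb
    rcases lt_trichotomy b k with h | h | h
    · refine lim_left hφ hp hV hV0 hb h fun s hs1 hs2 => ?_
      refine FF_le_left hφ hp hV hV0 hb hs1.le ?_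
      have hne2 : {k : ℝ | 0 < k ∧ A' k ≤ 1}.Nonempty := by
        by_contra hemp
        rw [not_nonempty_iff_eq_empty] at hemp
        rw [hemp, Real.sSup_empty] at hk2
        linarith
      obtain ⟨j, hj, hj2⟩ := exists_lt_of_lt_csSup hne2 (hs2.trans_le hk2)
      exact (h1 s j (hb.trans hs1) hj2).trans hj.2
    · rw [h]
    · refine lim_right hφ hp hV0 hk h fun s hs1 hs2 => ?_
      refine FF_le_right hφ hp hV hV0 (hk.trans hs1) hs2.le ?_
      obtain ⟨j, hj, hj2⟩ := exists_lt_of_csInf_lt hne (hk1.trans_lt hs1)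
      exact hj.2.trans (h2 j s hj.1 hj2)
  · intro hmin
    have hall : ∀ b, 0 < b → FF μ φ V k ≤ FF μ φ V b := fun b hb => by
      rw [← hmin]; exact iInf₂_le b hb
    have hfin : RR μ φ V k ≠ ⊤ := by
      rw [← FF_ne_top_iff hk]
      exact ne_top_of_le_ne_top ((FF_ne_top_iff hl).2 hR) (hall l hl)
    constructor
    · by_contra! hlt
      obtain ⟨b, hb1, hb2⟩ := exists_between hlt
      obtain ⟨c, hc1, hc2⟩ := exists_between hb2
      have hcA : A' c < 1 := by
        by_contra! hc
        exact absurd (csInf_le hbd0 ⟨hk.trans (hb1.trans hc1), hc⟩) (not_le.2 hc2)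
      have := FF_lt_left hφ hp hV hV0 hk hb1 ((h1 b c (hk.trans hb1) hc1).trans_lt hcA) hfin
      exact absurd (hall b (hk.trans hb1)) (not_le.2 this)
    · by_contra! hlt
      have hss : 0 ≤ sSup {k : ℝ | 0 < k ∧ A' k ≤ 1} := Real.sSup_nonneg fun x hx => hx.1.le
      obtain ⟨a, ha1, ha2⟩ := exists_between hlt
      obtain ⟨c, hc1, hc2⟩ := exists_between ha1
      have hcpos : 0 < c := by linarith
      have hcA : 1 < A' c := by
        by_contra! hc
        exact absurd (le_csSup hbdd ⟨hcpos, hc⟩) (not_le.2 hc1)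
      have hapos : 0 < a := by linarith
      have hfa : RR μ φ V a ≠ ⊤ := ne_top_of_le_ne_top hfin (RR_mono hφ hp hV0 hapos.le ha2.le)
      have := FF_lt_right hφ hp hV hV0 hapos ha2 (hcA.trans_le (h2 c a hcpos hc2)) hfa
      exact absurd (hall a hapos) (not_le.2 this)

/-- crossing -/
lemma crossing (hφ : IsN φ) (hp : IsRightDeriv φ p) (hV : Measurable V) (hV0 : ∀ t, 0 ≤ V t)
    {l : ℝ} (hl : 0 < l) (hR : RR μ φ V l ≠ ⊤) (h0 : ¬ ∀ᵐ t ∂μ, V t = 0) {r : ℝ} (hr : 1 < r) :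
    ∃ k, 0 < k ∧ AA μ φ p V k ≤ 1 ∧ 1 < AA μ φ p V (r * k) := by
  obtain ⟨K, hK, hK1⟩ := exists_large hφ hp hV hV0 h0
  obtain ⟨k1, hk1, hk1A⟩ := exists_small hφ hp hV hV0 hl hR
  set S := {k : ℝ | 0 < k ∧ AA μ φ p V k ≤ 1} with hS
  have hbdd : BddAbove S := by
    refine ⟨K, ?_⟩
    rintro j ⟨hj, hj1⟩
    by_contra! hlt
    exact absurd ((AA_mono hφ hp hV0 hK.le hlt.le).trans hj1) (not_le.2 hK1)
  have hs : 0 < sSup S := hk1.trans_le (le_csSup hbdd ⟨hk1, hk1A⟩)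
  have : sSup S / r < sSup S := div_lt_self hs hr
  obtain ⟨k, hk, hk2⟩ := exists_lt_of_lt_csSup (s := S) ⟨k1, hk1, hk1A⟩ this
  refine ⟨k, hk.1, hk.2, ?_⟩
  by_contra! hcon
  have hk0 := hk.1
  have : r * k ≤ sSup S := le_csSup hbdd ⟨by positivity, hcon⟩
  rw [div_lt_iff₀ (by linarith)] at hk2
  linarith

end abs2

section rearr
variable {γ : ℝ≥0∞}

lemma measII : MeasurableSet (II γ) := by
  unfold II
  exact (measurableSet_Ici (a := (0:ℝ))).inter
    (measurableSet_lt ENNReal.measurable_ofReal measurable_const)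

lemma rear_nonneg (f : ℝ → ℝ) (t : ℝ) : 0 ≤ rear γ f t :=
  Real.sInf_nonneg fun _ hx => hx.1.le

open scoped Pointwise in
lemma rear_smul (f : ℝ → ℝ) {k : ℝ} (hk : 0 < k) (t : ℝ) :
    rear γ (fun t => k * f t) t = k * rear γ f t := by
  unfold rear
  have : {l : ℝ | 0 < l ∧ df γ (fun t => k * f t) l ≤ ENNReal.ofReal t}
      = k • {l : ℝ | 0 < l ∧ df γ f l ≤ ENNReal.ofReal t} := by
    ext l
    rw [Set.mem_smul_set_iff_inv_smul_mem₀ hk.ne']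
    simp only [mem_ofPred_eq, smul_eq_mul]
    have h1 : 0 < l ↔ 0 < k⁻¹ * l := by
      constructor
      · intro h; positivity
      · intro h; exact (pos_iff_pos_of_mul_pos h).1 (by positivity)
    have h2 : df γ (fun t => k * f t) l = df γ f (k⁻¹ * l) := by
      unfold df
      congr 1; ext s
      simp only [mem_ofPred_eq, abs_mul, abs_of_pos hk]
      rw [inv_mul_lt_iff₀ hk]
    rw [h1, h2]
  rw [this, Real.sInf_smul_of_nonneg hk.le, smul_eq_mul]

lemma df_anti (f : ℝ → ℝ) {a b : ℝ} (h : a ≤ b) : df γ f b ≤ df γ f a :=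
  measure_mono fun _ hs => ⟨hs.1, h.trans_lt hs.2⟩

lemma dicho {f : ℝ → ℝ} (hf : Measurable f) :
    (∀ l, 0 < l → df γ f l = ⊤) ∨
      (∀ t : ℝ, 0 < t → ∃ l, 0 < l ∧ df γ f l ≤ ENNReal.ofReal t) := by
  by_cases h : ∀ l, 0 < l → df γ f l = ⊤
  · exact Or.inl h
  right
  push Not at h
  obtain ⟨l, hl, hfin⟩ := h
  intro t ht
  obtain ⟨N, hN⟩ := exists_nat_gt l
  have hN0 : (0:ℝ) < N := hl.trans hN
  have key : Tendsto (fun n : ℕ => df γ f n) atTop (𝓝 (volume (⋂ n : ℕ, {s | s ∈ II γ ∧ (n:ℝ) < |f s|}))) := by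
    refine tendsto_measure_iInter_atTop (fun n => ?_) ?_ ⟨N, ?_⟩
    · exact (measII.inter (measurableSet_lt measurable_const
        (continuous_abs.measurable.comp hf))).nullMeasurableSet
    · intro m n hmn s hs
      exact ⟨hs.1, lt_of_le_of_lt (by exact_mod_cast hmn) hs.2⟩
    · exact ne_top_of_le_ne_top hfin (df_anti f hN.le)
  have hemp : (⋂ n : ℕ, {s | s ∈ II γ ∧ (n:ℝ) < |f s|}) = ∅ := by
    ext s
    simp only [mem_iInter, mem_ofPred_eq, mem_empty_iff_false, iff_false, not_forall]
    obtain ⟨n, hn⟩ := exists_nat_gt |f s|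
    exact ⟨n, fun h => absurd h.2 (not_lt.2 hn.le)⟩
  rw [hemp, measure_empty] at key
  have h1 := key.eventually_lt_const (by simpa using ht : (0:ℝ≥0∞) < ENNReal.ofReal t)
  obtain ⟨n, hn1, hn2⟩ := (h1.and (eventually_gt_atTop 0)).exists
  exact ⟨n, by exact_mod_cast hn2, hn1.le⟩

lemma rear_top {f : ℝ → ℝ} (h : ∀ l, 0 < l → df γ f l = ⊤) (t : ℝ) : rear γ f t = 0 := by
  unfold rear
  have : {l : ℝ | 0 < l ∧ df γ f l ≤ ENNReal.ofReal t} = ∅ := by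
    ext l
    simp only [mem_ofPred_eq, mem_empty_iff_false, iff_false, not_and]
    intro hl
    rw [h l hl]; simp
  rw [this, Real.sInf_empty]

lemma rear_le_of {f : ℝ → ℝ} {t l : ℝ} (hl : 0 < l) (h : df γ f l ≤ ENNReal.ofReal t) :
    rear γ f t ≤ l :=
  csInf_le ⟨0, fun _ hx => hx.1.le⟩ ⟨hl, h⟩

lemma df_le_of {f : ℝ → ℝ} {t l : ℝ} (hne : ∃ l, 0 < l ∧ df γ f l ≤ ENNReal.ofReal t)
    (h : rear γ f t < l) : df γ f l ≤ ENNReal.ofReal t := by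
  obtain ⟨c, hc, hc2⟩ := exists_lt_of_csInf_lt hne h
  exact (df_anti f hc2.le).trans hc.2

lemma rear_anti {f : ℝ → ℝ} (hf : Measurable f) : AntitoneOn (rear γ f) (Ioi 0) := by
  rcases dicho (γ := γ) hf with h | h
  · intro s _ t _ _
    rw [rear_top h, rear_top h]
  · intro s hs t ht hst
    refine csInf_le_csInf ⟨0, fun _ hx => hx.1.le⟩ (h s hs) ?_
    intro l hl
    exact ⟨hl.1, hl.2.trans (ENNReal.ofReal_le_ofReal hst)⟩

variable {φ p : ℝ → ℝ}

lemma rear_p_low (hφ : IsN φ) (hp : IsRightDeriv φ p) {f : ℝ → ℝ} (hf : Measurable f) {a b t : ℝ}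
    (ha : 0 < a) (hab : a < b) (ht : 0 < t) :
    p (a * rear γ f t) ≤ rear γ (fun s => p (b * |f s|)) t := by
  have hb : 0 < b := ha.trans hab
  rcases (rear_nonneg (γ := γ) f t).eq_or_lt with h0 | h0
  · rw [← h0, mul_zero, p_zero hφ hp]; exact rear_nonneg _ _
  have hne : ∃ l, 0 < l ∧ df γ f l ≤ ENNReal.ofReal t := by
    rcases dicho (γ := γ) hf with h | h
    · rw [rear_top h] at h0; exact absurd h0 (lt_irrefl _)
    · exact h t ht
  set U := rear γ f t with hU
  refine le_csInf ?_ ?_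
  · obtain ⟨M, hM, hM2⟩ := hne
    refine ⟨p (b * M), p_pos hφ hp (by positivity), le_trans (measure_mono ?_) hM2⟩
    rintro s ⟨hs1, hs2⟩
    refine ⟨hs1, ?_⟩
    by_contra! hcon
    rw [abs_of_nonneg (p_nonneg hφ hp (by positivity))] at hs2
    exact absurd (p_mono hφ hp (by positivity) (mul_le_mul_of_nonneg_left hcon hb.le))
      (not_le.2 hs2)
  · rintro c ⟨hc, hc2⟩
    by_contra! hlt
    have hl : a * U / b < U := by rw [div_lt_iff₀ hb]; nlinarith
    have hl0 : 0 < a * U / b := by positivity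
    have e : b * (a * U / b) = a * U := by field_simp
    refine absurd (rear_le_of (f := f) (γ := γ) (t := t) hl0 (le_trans (measure_mono ?_) hc2))
      (not_le.2 hl)
    rintro s ⟨hs1, hs2⟩
    refine ⟨hs1, ?_⟩
    rw [abs_of_nonneg (p_nonneg hφ hp (by positivity))]
    refine hlt.trans_le (p_mono hφ hp (by positivity) ?_)
    rw [← e]
    exact mul_le_mul_of_nonneg_left hs2.le hb.le

lemma rear_p_up (hφ : IsN φ) (hp : IsRightDeriv φ p) {f : ℝ → ℝ} (hf : Measurable f) {a b t : ℝ}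
    (ha : 0 < a) (hab : a < b) (ht : 0 < t) :
    rear γ (fun s => p (a * |f s|)) t ≤ p (b * rear γ f t) := by
  have hb : 0 < b := ha.trans hab
  rcases dicho (γ := γ) hf with h | h
  · have : ∀ l, 0 < l → df γ (fun s => p (a * |f s|)) l = ⊤ := by
      intro l hl
      obtain ⟨M, hM, hM2⟩ := p_top hφ hp l
      rw [eq_top_iff, ← h (M / a) (by positivity)]
      refine measure_mono ?_
      rintro s ⟨hs1, hs2⟩
      refine ⟨hs1, ?_⟩
      rw [abs_of_nonneg (p_nonneg hφ hp (by positivity))]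
      refine hM2.trans_le (p_mono hφ hp hM.le ?_)
      rw [div_lt_iff₀ ha] at hs2; linarith
    rw [rear_top this, rear_top h, mul_zero, p_zero hφ hp]
  have key : ∀ l, 0 < l → rear γ f t < l → rear γ (fun s => p (a * |f s|)) t ≤ p (a * l) := by
    intro l hl hlt
    refine rear_le_of (p_pos hφ hp (by positivity)) (le_trans (measure_mono ?_)
      (df_le_of (h t ht) hlt))
    rintro s ⟨hs1, hs2⟩
    refine ⟨hs1, ?_⟩
    by_contra! hcon
    rw [abs_of_nonneg (p_nonneg hφ hp (by positivity))] at hs2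
    exact absurd (p_mono hφ hp (by positivity) (mul_le_mul_of_nonneg_left hcon ha.le))
      (not_le.2 hs2)
  rcases (rear_nonneg (γ := γ) f t).eq_or_lt with h0 | h0
  · rw [← h0, mul_zero, p_zero hφ hp]
    by_contra! hpos
    obtain ⟨u, hu, hu2⟩ := p_small hφ hp hpos
    have := key (u / a) (by positivity) (by rw [← h0]; positivity)
    rw [mul_div_cancel₀ _ ha.ne'] at this
    linarith
  · set U := rear γ f t
    have := key (b * U / a) (by positivity) (by rw [lt_div_iff₀ ha]; nlinarith)
    rwa [mul_div_cancel₀ _ ha.ne'] at this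

lemma rear_le_self {g : ℝ → ℝ} (hg0 : ∀ t, 0 ≤ g t) (hg : AntitoneOn g (Ioi 0)) {t : ℝ}
    (ht : 0 < t) : rear γ g t ≤ g t := by
  have key : ∀ l, 0 < l → g t ≤ l → rear γ g t ≤ l := by
    intro l hl hlt
    refine rear_le_of hl ?_
    have : {s | s ∈ II γ ∧ l < |g s|} ⊆ Icc 0 t := by
      rintro s ⟨hs1, hs2⟩
      refine ⟨hs1.1, ?_⟩
      by_contra! hcon
      rw [abs_of_nonneg (hg0 s)] at hs2
      have := hg (mem_Ioi.2 ht) (mem_Ioi.2 (ht.trans hcon)) hcon.le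
      linarith
    refine (measure_mono this).trans ?_
    simp
  exact le_of_forall_pos_le_add fun ε hε => key _ (by have := hg0 t; positivity) (by linarith)

lemma le_rear_self {g : ℝ → ℝ} (hg0 : ∀ t, 0 ≤ g t) (hg : AntitoneOn g (Ioi 0)) {t t' : ℝ}
    (ht : 0 < t) (htt : t < t') (ht' : t' ∈ II γ) : g t' ≤ rear γ g t := by
  refine le_csInf ⟨g t + 1, by have := hg0 t; positivity, ?_⟩ ?_
  · have : {s | s ∈ II γ ∧ g t + 1 < |g s|} ⊆ Icc 0 t := by
      rintro s ⟨hs1, hs2⟩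
      refine ⟨hs1.1, ?_⟩
      by_contra! hcon
      rw [abs_of_nonneg (hg0 s)] at hs2
      have := hg (mem_Ioi.2 ht) (mem_Ioi.2 (ht.trans hcon)) hcon.le
      linarith
    refine (measure_mono this).trans ?_
    simp
  · rintro l ⟨hl, hl2⟩
    by_contra! hlt
    have : Ioo 0 t' ⊆ {s | s ∈ II γ ∧ l < |g s|} := by
      rintro s ⟨hs1, hs2⟩
      refine ⟨⟨hs1.le, lt_of_le_of_lt (ENNReal.ofReal_le_ofReal hs2.le) ht'.2⟩, ?_⟩
      rw [abs_of_nonneg (hg0 s)]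
      exact hlt.trans_le (hg (mem_Ioi.2 hs1) (mem_Ioi.2 (ht.trans htt)) hs2.le)
    have h3 := (measure_mono this).trans hl2
    rw [Real.volume_Ioo, sub_zero, ENNReal.ofReal_le_ofReal_iff ht.le] at h3
    linarith

lemma exists_gt_II {t u : ℝ} (ht : t ∈ II γ) (hu : t < u) : ∃ t', t < t' ∧ t' < u ∧ t' ∈ II γ := by
  have : ∀ᶠ x in 𝓝[>] t, ENNReal.ofReal x < γ := by
    have := (ENNReal.continuous_ofReal.tendsto t).eventually_lt_const ht.2
    exact this.filter_mono nhdsWithin_le_nhds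
  obtain ⟨x, hx1, hx2⟩ := (this.and (Ioo_mem_nhdsGT hu)).exists
  exact ⟨x, hx2.1, hx2.2, ht.1.trans hx2.1.le, hx1⟩

lemma rear_ae_self {g : ℝ → ℝ} (hg0 : ∀ t, 0 ≤ g t) (hg : AntitoneOn g (Ioi 0)) :
    ∀ᵐ t ∂(volume.restrict (II γ)), rear γ g t = g t := by
  have hc := hg.countable_not_continuousWithinAt
  have h1 : ∀ᵐ t ∂(volume.restrict (II γ)), t ∉ {x | x ∈ Ioi 0 ∧ ¬ContinuousWithinAt g (Ioi 0) x} :=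
    ae_restrict_of_ae (measure_eq_zero_iff_ae_notMem.1 (hc.measure_zero volume))
  have h2 : ∀ᵐ t ∂(volume.restrict (II γ)), t ≠ (0:ℝ) :=
    ae_restrict_of_ae (by simp [ae_iff])
  filter_upwards [h1, h2, ae_restrict_mem measII] with t ht1 ht2 ht3
  have ht : 0 < t := lt_of_le_of_ne ht3.1 (Ne.symm ht2)
  refine le_antisymm (rear_le_self hg0 hg ht) ?_
  by_contra! hlt
  have hcont : ContinuousWithinAt g (Ioi 0) t := by
    by_contra h; exact ht1 ⟨ht, h⟩
  have hca : ContinuousAt g t := hcont.continuousAt (Ioi_mem_nhds ht)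
  have := hca.eventually_const_lt hlt
  obtain ⟨ε, hε, hball⟩ := Metric.eventually_nhds_iff.1 this
  obtain ⟨t', h1, h2, h3⟩ := exists_gt_II ht3 (by linarith : t < t + ε)
  have h4 := hball (y := t') (by rw [Real.dist_eq, abs_of_pos (by linarith)]; linarith)
  have h5 := le_rear_self hg0 hg ht h1 h3
  linarith

lemma meas_anti {g : ℝ → ℝ} (hg0 : ∀ t, 0 ≤ g t) (hg : AntitoneOn g (Ioi 0))
    (hz : ∀ t, t ≤ 0 → g t = 0) : Measurable g := by
  refine measurable_of_Ioi fun c => ?_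
  rcases lt_or_ge c 0 with hc | hc
  · have : g ⁻¹' Ioi c = univ := by
      ext t; simp only [mem_preimage, mem_Ioi, mem_univ, iff_true]
      exact hc.trans_le (hg0 t)
    rw [this]; exact MeasurableSet.univ
  · apply OrdConnected.measurableSet
    refine ⟨?_⟩
    intro x hx y hy z hz'
    have hx0 : 0 < x := by
      by_contra! h
      have : c < g x := hx
      rw [hz x h] at this; linarith
    have hz0 : 0 < z := hx0.trans_le hz'.1
    have hy' : c < g y := hy
    exact hy'.trans_le (hg hz0 (hz0.trans_le hz'.2) hz'.2)

end rearr

section final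
variable {γ : ℝ≥0∞} {w φ p : ℝ → ℝ}

def nu (γ : ℝ≥0∞) (w : ℝ → ℝ) : Measure ℝ :=
  (volume.restrict (II γ)).withDensity (fun t => ENNReal.ofReal (w t))

lemma lint_nu (hw : IsWeight γ w) (h : ℝ → ℝ) :
    ∫⁻ t in II γ, ENNReal.ofReal (h t * w t) = ∫⁻ t, ENNReal.ofReal (h t) ∂(nu γ w) := by
  unfold nu
  rw [lintegral_withDensity_eq_lintegral_mul_non_measurable _ hw.1.ennreal_ofReal
    (ae_of_all _ fun t => ENNReal.ofReal_lt_top)]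
  refine setLIntegral_congr_fun measII fun t ht => ?_
  simp only [Pi.mul_apply]
  rw [ENNReal.ofReal_mul' (hw.2.1 t ht).le, mul_comm]

lemma nu_ae {P : ℝ → Prop} (h : ∀ᵐ t ∂(volume.restrict (II γ)), P t) : ∀ᵐ t ∂(nu γ w), P t :=
  (withDensity_absolutelyContinuous _ _).ae_le h

lemma ae_pos : ∀ᵐ t ∂(volume.restrict (II γ)), 0 < t ∧ t ∈ II γ := by
  have h2 : ∀ᵐ t ∂(volume.restrict (II γ)), t ≠ (0:ℝ) :=
    ae_restrict_of_ae (by simp [ae_iff])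
  filter_upwards [h2, ae_restrict_mem measII] with t ht2 ht3
  exact ⟨lt_of_le_of_ne ht3.1 (Ne.symm ht2), ht3⟩

open Classical in
def VV (γ : ℝ≥0∞) (f : ℝ → ℝ) (t : ℝ) : ℝ := if 0 < t then rear γ f t else 0

lemma VV_pos {f : ℝ → ℝ} {t : ℝ} (ht : 0 < t) : VV γ f t = rear γ f t := by simp [VV, ht]

lemma VV_zero {f : ℝ → ℝ} {t : ℝ} (ht : t ≤ 0) : VV γ f t = 0 := by simp [VV, not_lt.2 ht]

lemma VV_nonneg (f : ℝ → ℝ) (t : ℝ) : 0 ≤ VV γ f t := by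
  unfold VV; split_ifs
  · exact rear_nonneg _ _
  · exact le_rfl

lemma VV_anti {f : ℝ → ℝ} (hf : Measurable f) : AntitoneOn (VV γ f) (Ioi 0) := by
  intro s hs t ht hst
  rw [VV_pos hs, VV_pos ht]; exact rear_anti hf hs ht hst

lemma VV_meas {f : ℝ → ℝ} (hf : Measurable f) : Measurable (VV γ f) :=
  meas_anti (VV_nonneg f) (VV_anti hf) fun _ ht => VV_zero ht

lemma rho_RR (hw : IsWeight γ w) (f : ℝ → ℝ) {k : ℝ} (hk : 0 < k) :
    rho γ φ w (fun t => k * f t) = RR (nu γ w) φ (VV γ f) k := by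
  unfold rho RR
  rw [lint_nu hw]
  refine lintegral_congr_ae (nu_ae ?_)
  filter_upwards [ae_pos] with t ht
  rw [rear_smul f hk, VV_pos ht.1]

lemma A_low (hw : IsWeight γ w) (hφ : IsN φ) (hp : IsRightDeriv φ p) {f : ℝ → ℝ}
    (hf : Measurable f) {a b : ℝ} (ha : 0 < a) (hab : a < b) :
    AA (nu γ w) φ p (VV γ f) a ≤ rho γ (conj φ) w (fun t => p (b * |f t|)) := by
  unfold rho AA
  rw [lint_nu hw]
  refine lintegral_mono_ae (nu_ae ?_)
  filter_upwards [ae_pos] with t ht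
  rw [VV_pos ht.1]
  exact ENNReal.ofReal_le_ofReal (conj_mono hφ (rear_p_low hφ hp hf ha hab ht.1))

lemma A_up (hw : IsWeight γ w) (hφ : IsN φ) (hp : IsRightDeriv φ p) {f : ℝ → ℝ}
    (hf : Measurable f) {a b : ℝ} (ha : 0 < a) (hab : a < b) :
    rho γ (conj φ) w (fun t => p (a * |f t|)) ≤ AA (nu γ w) φ p (VV γ f) b := by
  unfold rho AA
  rw [lint_nu hw]
  refine lintegral_mono_ae (nu_ae ?_)
  filter_upwards [ae_pos] with t ht
  rw [VV_pos ht.1]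
  exact ENNReal.ofReal_le_ofReal (conj_mono hφ (rear_p_up hφ hp hf ha hab ht.1))

lemma orl_le (hw : IsWeight γ w) (hφ : IsN φ) (hp : IsRightDeriv φ p) {f : ℝ → ℝ}
    (hf : Measurable f) {k : ℝ} (hk : 0 < k) : orl γ φ w f ≤ FF (nu γ w) φ (VV γ f) k := by
  have hk' : ENNReal.ofReal k ≠ 0 := by simpa using hk
  refine iSup₂_le fun g hg => ?_
  rw [lint_nu hw (fun t => rear γ f t * rear γ g t)]
  unfold FF
  rw [mul_comm, ← div_eq_mul_inv, ENNReal.le_div_iff_mul_le (Or.inl hk')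
    (Or.inl ENNReal.ofReal_ne_top), mul_comm, ← lintegral_const_mul' _ _ ENNReal.ofReal_ne_top]
  have hm : Measurable (fun t => φ (k * VV γ f t)) :=
    meas_phi hφ hp ((VV_meas hf).const_mul k) (fun t => mul_nonneg hk.le (VV_nonneg f t))
  have hg2 := hg.2
  unfold rho at hg2
  rw [lint_nu hw] at hg2
  rw [add_comm]
  refine le_trans ?_ (add_le_add le_rfl hg2)
  unfold RR
  rw [← lintegral_add_left hm.ennreal_ofReal]
  refine lintegral_mono_ae (nu_ae ?_)
  filter_upwards [ae_pos] with t ht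
  rw [VV_pos ht.1, ← ENNReal.ofReal_mul hk.le, ← ENNReal.ofReal_add
    (phi_nonneg hφ (mul_nonneg hk.le (rear_nonneg _ _))) (conj_nonneg hφ _)]
  refine ENNReal.ofReal_le_ofReal ?_
  have := young hφ (mul_nonneg hk.le (rear_nonneg (γ := γ) f t)) (rear γ g t)
  linarith

lemma le_orl (hw : IsWeight γ w) (hφ : IsN φ) (hp : IsRightDeriv φ p) {f : ℝ → ℝ}
    (hf : Measurable f) {k k' : ℝ} (hk : 0 < k) (hkk : k ≤ k') {s : ℝ → ℝ}
    (hs : AntitoneOn s (Ioi 0)) (hs1 : ∀ t, k * VV γ f t ≤ s t) (hs2 : ∀ t, s t ≤ k' * VV γ f t)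
    (h1 : ∫⁻ t, ENNReal.ofReal (conj φ (p (s t))) ∂(nu γ w) = 1) :
    1 + RR (nu γ w) φ (VV γ f) k ≤ ENNReal.ofReal k' * orl γ φ w f := by
  have hk' : 0 < k' := hk.trans_le hkk
  have hkV : ∀ t, 0 ≤ k * VV γ f t := fun t => mul_nonneg hk.le (VV_nonneg f t)
  have hs0 : ∀ t, 0 ≤ s t := fun t => (hkV t).trans (hs1 t)
  have hg0 : ∀ t, 0 ≤ p (s t) := fun t => p_nonneg hφ hp (hs0 t)
  have hga : AntitoneOn (fun t => p (s t)) (Ioi 0) := fun x hx y hy hxy =>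
    p_mono hφ hp (hs0 y) (hs hx hy hxy)
  have hgz : ∀ t, t ≤ 0 → p (s t) = 0 := fun t ht => by
    have : s t = 0 := le_antisymm (by simpa [VV_zero ht] using hs2 t) (hs0 t)
    rw [this, p_zero hφ hp]
  have hgm : Measurable (fun t => p (s t)) := meas_anti hg0 hga hgz
  have hmem : (fun t => p (s t)) ∈ {g : ℝ → ℝ | Measurable g ∧ rho γ (conj φ) w g ≤ 1} := by
    refine ⟨hgm, ?_⟩
    rw [← h1]
    unfold rho
    rw [lint_nu hw]
    refine lintegral_mono_ae (nu_ae ?_)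
    filter_upwards [ae_pos] with t ht
    exact ENNReal.ofReal_le_ofReal (conj_mono hφ (rear_le_self hg0 hga ht.1))
  have h2 : ∫⁻ t in II γ, ENNReal.ofReal (rear γ f t * rear γ (fun t => p (s t)) t * w t)
      ≤ orl γ φ w f :=
    le_iSup₂ (f := fun g (_ : g ∈ {g : ℝ → ℝ | Measurable g ∧ rho γ (conj φ) w g ≤ 1}) =>
      ∫⁻ t in II γ, ENNReal.ofReal (rear γ f t * rear γ g t * w t)) _ hmem
  rw [lint_nu hw (fun t => rear γ f t * rear γ (fun t => p (s t)) t)] at h2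
  refine le_trans ?_ (mul_le_mul_right h2 _)
  rw [← lintegral_const_mul' _ _ ENNReal.ofReal_ne_top, ← h1, add_comm]
  have hm : Measurable (fun t => φ (k * VV γ f t)) :=
    meas_phi hφ hp ((VV_meas hf).const_mul k) hkV
  unfold RR
  rw [← lintegral_add_left hm.ennreal_ofReal]
  refine lintegral_mono_ae (nu_ae ?_)
  filter_upwards [ae_pos, rear_ae_self hg0 hga] with t ht htg
  rw [htg, ← ENNReal.ofReal_mul hk'.le, ← ENNReal.ofReal_add
    (phi_nonneg hφ (hkV t)) (conj_nonneg hφ _)]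
  refine ENNReal.ofReal_le_ofReal ?_
  rw [conj_p hφ hp (hs0 t)]
  have e1 := phi_mono hφ hp (hkV t) (hs1 t)
  have e2 := mul_le_mul_of_nonneg_right (hs2 t) (hg0 t)
  rw [VV_pos ht.1] at *
  linarith

lemma exists_T (hγ : 0 < γ) : ∃ T : ℕ → ℝ, Monotone T ∧ (∀ n, T n ∈ II γ) ∧
    ∀ t ∈ II γ, ∃ N, ∀ n ≥ N, t < T n := by
  by_cases h : γ = ⊤
  · subst h
    refine ⟨fun n => n, fun m n hmn => Nat.cast_le.2 hmn, fun n => ⟨by positivity, by simp⟩, ?_⟩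
    intro t _
    obtain ⟨N, hN⟩ := exists_nat_gt t
    exact ⟨N, fun n hn => hN.trans_le (Nat.cast_le.2 hn)⟩
  · have hg : 0 < γ.toReal := ENNReal.toReal_pos hγ.ne' h
    obtain ⟨u, hu1, hu2, hu3⟩ := exists_seq_strictMono_tendsto' hg
    refine ⟨u, hu1.monotone, fun n => ⟨(hu2 n).1.le,
      (ENNReal.ofReal_lt_iff_lt_toReal (hu2 n).1.le h).2 (hu2 n).2⟩, ?_⟩
    intro t ht
    have := (ENNReal.ofReal_lt_iff_lt_toReal ht.1 h).1 ht.2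
    exact eventually_atTop.1 (hu3.eventually_const_lt this)

lemma interp (hγ : 0 < γ) (hw : IsWeight γ w) (hφ : IsN φ) (hp : IsRightDeriv φ p)
    {V : ℝ → ℝ} (hV : Measurable V) (hV0 : ∀ t, 0 ≤ V t) (hVa : AntitoneOn V (Ioi 0))
    {k k' : ℝ} (hk : 0 < k) (hkk : k ≤ k') (hA : AA (nu γ w) φ p V k ≤ 1)
    (hA' : 1 < AA (nu γ w) φ p V k') :
    ∃ s : ℝ → ℝ, AntitoneOn s (Ioi 0) ∧ (∀ t, k * V t ≤ s t) ∧ (∀ t, s t ≤ k' * V t) ∧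
      ∫⁻ t, ENNReal.ofReal (conj φ (p (s t))) ∂(nu γ w) = 1 := by
  classical
  have hk' : 0 < k' := hk.trans_le hkk
  obtain ⟨T, hTm, hTI, hT⟩ := exists_T hγ
  have hkV : ∀ t, 0 ≤ k * V t := fun t => mul_nonneg hk.le (hV0 t)
  have hkkV : ∀ t, k * V t ≤ k' * V t := fun t => mul_le_mul_of_nonneg_right hkk (hV0 t)
  let m : ℕ → ℝ → ℝ := fun n t => max (k * V t) (min (k' * V t) n)
  let S : ℕ → ℝ → ℝ → ℝ := fun n τ t => if t < τ then m n t else k * V t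
  have hm1 : ∀ n t, k * V t ≤ m n t := fun n t => le_max_left _ _
  have hm2 : ∀ n t, m n t ≤ k' * V t := fun n t => max_le (hkkV t) (min_le_left _ _)
  have hS1 : ∀ n τ t, k * V t ≤ S n τ t := by
    intro n τ t; simp only [S]; split_ifs
    · exact hm1 n t
    · exact le_rfl
  have hS2 : ∀ n τ t, S n τ t ≤ k' * V t := by
    intro n τ t; simp only [S]; split_ifs
    · exact hm2 n t
    · exact hkkV t
  have hmm : ∀ n, Measurable (m n) := fun n =>
    (hV.const_mul k).max ((hV.const_mul k').min measurable_const)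
  have hSm : ∀ n τ, Measurable (S n τ) := fun n τ =>
    Measurable.ite measurableSet_Iio (hmm n) (hV.const_mul k)
  have hma : ∀ n, AntitoneOn (m n) (Ioi 0) := by
    intro n x hx y hy hxy
    have := hVa hx hy hxy
    exact max_le_max (mul_le_mul_of_nonneg_left this hk.le)
      (min_le_min (mul_le_mul_of_nonneg_left this hk'.le) le_rfl)
  have hSa : ∀ n τ, AntitoneOn (S n τ) (Ioi 0) := by
    intro n τ x hx y hy hxy
    have := mul_le_mul_of_nonneg_left (hVa hx hy hxy) hk.le
    by_cases h1 : y < τ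
    · have h2 : x < τ := hxy.trans_lt h1
      simp only [S, h1, h2, if_true]
      exact hma n hx hy hxy
    · simp only [S, h1, if_false]
      exact this.trans (hS1 n τ x)
  -- choose n
  have hlim : Tendsto (fun n => ∫⁻ t, ENNReal.ofReal (conj φ (p (S n (T n) t))) ∂(nu γ w)) atTop
      (𝓝 (AA (nu γ w) φ p V k')) := by
    refine lintegral_tendsto_of_tendsto_of_monotone (fun n => ?_) ?_ (nu_ae ?_)
    · exact (meas_q hφ hp (hSm n _) fun t =>
        (hkV t).trans (hS1 n _ t)).ennreal_ofReal.aemeasurable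
    · refine ae_of_all _ fun t a b hab => ENNReal.ofReal_le_ofReal
        (conj_p_mono hφ hp ((hkV t).trans (hS1 a _ t)) ?_)
      by_cases h1 : t < T a
      · have h2 : t < T b := h1.trans_le (hTm hab)
        simp only [S, h1, h2, if_true]
        exact max_le_max le_rfl (min_le_min le_rfl (by exact_mod_cast hab))
      · have : S a (T a) t = k * V t := by simp only [S, h1, if_false]
        rw [this]; exact hS1 b _ t
    · filter_upwards [ae_pos] with t ht
      refine tendsto_const_nhds.congr' ?_
      obtain ⟨N, hN⟩ := hT t ht.2
      obtain ⟨N', hN'⟩ := exists_nat_gt (k' * V t)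
      filter_upwards [eventually_ge_atTop N, eventually_ge_atTop N'] with n hn hn'
      have h2 : k' * V t ≤ n := hN'.le.trans (by exact_mod_cast hn')
      have : S n (T n) t = k' * V t := by
        simp only [S, hN n hn, if_true, m, min_eq_left h2, max_eq_right (hkkV t)]
      rw [this]
  obtain ⟨n, hn⟩ := (hlim.eventually_const_lt hA').exists
  have hTn := hTI n
  set τ₁ := T n with hτ₁
  let d : ℝ → ℝ := fun t => conj φ (p (m n t)) - conj φ (p (k * V t))
  have hd0 : ∀ t, 0 ≤ d t := fun t => sub_nonneg.2 (conj_p_mono hφ hp (hkV t) (hm1 n t))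
  have hdC : ∀ t, d t ≤ conj φ (p n) := by
    intro t
    have hn0 := conj_nonneg hφ (p n)
    rcases le_total (k * V t) n with h | h
    · have : m n t ≤ n := max_le h (min_le_right _ _)
      have := conj_p_mono hφ hp ((hkV t).trans (hm1 n t)) this
      have := conj_nonneg hφ (p (k * V t))
      simp only [d]; linarith
    · have : m n t = k * V t := max_eq_left ((min_le_right _ _).trans h)
      simp only [d, this]; simpa using hn0
  have hqk : Measurable (fun t => conj φ (p (k * V t))) := meas_q hφ hp (hV.const_mul k) hkV
  have hdm : Measurable d :=
    (meas_q hφ hp (hmm n) fun t => (hkV t).trans (hm1 n t)).sub hqk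
  have hsub : ∀ t, 0 ≤ t → t ≤ τ₁ → t ∈ II γ := fun t h1 h2 =>
    ⟨h1, lt_of_le_of_lt (ENNReal.ofReal_le_ofReal h2) hTn.2⟩
  have hint : IntegrableOn (fun t => d t * w t) (Icc 0 τ₁) volume := by
    refine Integrable.mono' ((hw.2.2.2.1 τ₁ hTn).const_mul (conj φ (p n)))
      (hdm.mul hw.1).aestronglyMeasurable ?_
    filter_upwards [ae_restrict_mem measurableSet_Icc] with t ht
    have hwt := (hw.2.1 t (hsub t ht.1 ht.2)).le
    rw [Real.norm_of_nonneg (mul_nonneg (hd0 t) hwt)]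
    exact mul_le_mul_of_nonneg_right (hdC t) hwt
  have hcont : ContinuousOn (fun τ => ∫ t in Ioc 0 τ, d t * w t) (Icc 0 τ₁) :=
    intervalIntegral.continuousOn_primitive hint
  have hform : ∀ τ, 0 ≤ τ → τ ≤ τ₁ → ∫⁻ t, ENNReal.ofReal (conj φ (p (S n τ t))) ∂(nu γ w)
      = AA (nu γ w) φ p V k + ENNReal.ofReal (∫ t in Ioc 0 τ, d t * w t) := by
    intro τ h0 h1
    have hsplit : ∀ t, ENNReal.ofReal (conj φ (p (S n τ t))) =
        ENNReal.ofReal (conj φ (p (k * V t))) + ENNReal.ofReal ((Iio τ).indicator d t) := by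
      intro t
      by_cases h : t < τ
      · rw [indicator_of_mem (mem_Iio.2 h), ← ENNReal.ofReal_add (conj_nonneg hφ _) (hd0 t)]
        simp only [S, h, if_true, d]; congr 1; ring
      · rw [indicator_of_notMem (by simpa using h)]
        simp only [S, h, if_false]; simp
    simp_rw [hsplit]
    rw [lintegral_add_left hqk.ennreal_ofReal]
    congr 1
    rw [← lint_nu hw]
    rw [ofReal_integral_eq_lintegral_ofReal
      (hint.mono_set (Ioc_subset_Icc_self.trans (Icc_subset_Icc le_rfl h1)))]
    · rw [← lintegral_indicator measII, ← lintegral_indicator measurableSet_Ioc]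
      refine lintegral_congr_ae ?_
      have e0 : ∀ᵐ t ∂(volume : Measure ℝ), t ≠ 0 := by simp [ae_iff]
      have e1 : ∀ᵐ t ∂(volume : Measure ℝ), t ≠ τ := by simp [ae_iff]
      filter_upwards [e0, e1] with t ht0 ht1
      by_cases hI : t ∈ Ioc 0 τ
      · rw [indicator_of_mem hI, indicator_of_mem (hsub t hI.1.le (hI.2.trans h1)),
          indicator_of_mem (mem_Iio.2 (lt_of_le_of_ne hI.2 ht1))]
      · rw [indicator_of_notMem hI]
        by_cases hII : t ∈ II γ
        · rw [indicator_of_mem hII, indicator_of_notMem]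
          · simp
          · intro hlt
            exact hI ⟨lt_of_le_of_ne hII.1 (Ne.symm ht0), (mem_Iio.1 hlt).le⟩
        · rw [indicator_of_notMem hII]
    · filter_upwards [ae_restrict_mem measurableSet_Ioc] with t ht
      exact mul_nonneg (hd0 t) (hw.2.1 t (hsub t ht.1.le (ht.2.trans h1))).le
  set a := (AA (nu γ w) φ p V k).toReal with ha
  have hAtop : AA (nu γ w) φ p V k ≠ ⊤ := ne_top_of_le_ne_top one_ne_top hA
  have haA : AA (nu γ w) φ p V k = ENNReal.ofReal a := (ENNReal.ofReal_toReal hAtop).symm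
  have ha0 : 0 ≤ a := ENNReal.toReal_nonneg
  have ha1 : a ≤ 1 := by
    rw [haA] at hA; simpa using hA
  have hD : 1 - a ≤ ∫ t in Ioc 0 τ₁, d t * w t := by
    by_contra! hcon
    rw [hform τ₁ hTn.1 le_rfl, haA] at hn
    have : ENNReal.ofReal a + ENNReal.ofReal (∫ t in Ioc 0 τ₁, d t * w t) ≤ 1 := by
      calc _ ≤ ENNReal.ofReal a + ENNReal.ofReal (1 - a) := by gcongr
        _ = 1 := by rw [← ENNReal.ofReal_add ha0 (by linarith)]; simp
    exact absurd hn (not_lt.2 this)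
  have hmem : 1 - a ∈ Icc (∫ t in Ioc 0 (0:ℝ), d t * w t) (∫ t in Ioc 0 τ₁, d t * w t) := by
    refine ⟨?_, hD⟩
    simpa using ha1
  obtain ⟨τ, hτ, hτe⟩ := intermediate_value_Icc hTn.1 hcont hmem
  refine ⟨S n τ, hSa n τ, hS1 n τ, hS2 n τ, ?_⟩
  rw [hform τ hτ.1 hτ.2, haA]
  simp only at hτe
  rw [hτe, ← ENNReal.ofReal_add ha0 (by linarith)]; simp

lemma orl_eq (hγ : 0 < γ) (hw : IsWeight γ w) (hφ : IsN φ) (hp : IsRightDeriv φ p) {f : ℝ → ℝ}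
    (hf : Measurable f) {l : ℝ} (hl : 0 < l) (hR : RR (nu γ w) φ (VV γ f) l ≠ ⊤) :
    orl γ φ w f = ⨅ k ∈ Ioi (0:ℝ), FF (nu γ w) φ (VV γ f) k := by
  refine le_antisymm (le_iInf₂ fun k hk => orl_le hw hφ hp hf hk) ?_
  by_cases h0 : ∀ᵐ t ∂(nu γ w), VV γ f t = 0
  · rw [inf_triv hφ h0]; exact bot_le
  set m := ⨅ k ∈ Ioi (0:ℝ), FF (nu γ w) φ (VV γ f) k with hm
  have key : ∀ r : ℝ, 1 < r → m ≤ ENNReal.ofReal r * orl γ φ w f := by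
    intro r hr
    obtain ⟨k, hk, hk1, hk2⟩ := crossing hφ hp (VV_meas hf) (VV_nonneg f) hl hR h0 hr
    have hkr : k ≤ r * k := by nlinarith
    obtain ⟨s, s1, s2, s3, s4⟩ := interp hγ hw hφ hp (VV_meas hf) (VV_nonneg f) (VV_anti hf) hk
      hkr hk1 hk2
    have h := le_orl hw hφ hp hf hk hkr s1 s2 s3 s4
    have hk' : ENNReal.ofReal k ≠ 0 := by simpa using hk
    refine (iInf₂_le k hk).trans ?_
    unfold FF
    rw [mul_comm, ← div_eq_mul_inv, ENNReal.div_le_iff hk' ENNReal.ofReal_ne_top]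
    refine h.trans (le_of_eq ?_)
    rw [ENNReal.ofReal_mul (by linarith)]; ring
  have ht : Tendsto (fun r => ENNReal.ofReal r * orl γ φ w f) (𝓝[>] (1:ℝ))
      (𝓝 (ENNReal.ofReal 1 * orl γ φ w f)) := by
    refine ENNReal.Tendsto.mul_const ?_ (Or.inl (by simp))
    exact (ENNReal.continuous_ofReal.tendsto 1).mono_left nhdsWithin_le_nhds
  have := ge_of_tendsto ht (b := m) (by
    filter_upwards [self_mem_nhdsWithin] with r hr
    exact key r hr)
  simpa using this

end final

/-- `‖f‖⁰ = inf_{k>0} (1/k)(1 + ρ_{φ,w}(kf))`, and for `k > 0`,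
`k ∈ K(f) = [k^*(f), k^{**}(f)]` iff `‖f‖⁰ = (1/k)(1 + ρ_{φ,w}(kf))`. -/
theorem statement1 (γ : ℝ≥0∞) (hγ : 0 < γ) (w : ℝ → ℝ) (hw : IsWeight γ w)
    (φ p : ℝ → ℝ) (hφ : IsN φ) (hp : IsRightDeriv φ p)
    (f : ℝ → ℝ) (hf : MemL γ φ w f) :
    (orl γ φ w f =
      ⨅ k ∈ Ioi (0:ℝ), (ENNReal.ofReal k)⁻¹ * (1 + rho γ φ w (fun t => k * f t))) ∧
    ∀ k : ℝ, 0 < k →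
      (k ∈ Icc (kstar γ φ w p f) (kstarstar γ φ w p f) ↔
        orl γ φ w f = (ENNReal.ofReal k)⁻¹ * (1 + rho γ φ w (fun t => k * f t))) := by
  obtain ⟨hfm, l, hl, hfin⟩ := hf
  have hR : RR (nu γ w) φ (VV γ f) l ≠ ⊤ := by
    rw [← rho_RR hw f hl]; exact hfin.ne
  have hF : ∀ k : ℝ, 0 < k → (ENNReal.ofReal k)⁻¹ * (1 + rho γ φ w (fun t => k * f t))
      = FF (nu γ w) φ (VV γ f) k := fun k hk => by
    rw [rho_RR hw f hk]; rfl
  have hO := orl_eq hγ hw hφ hp hfm hl hR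
  refine ⟨?_, ?_⟩
  · rw [hO]
    exact iInf_congr fun k => iInf_congr fun hk => (hF k hk).symm
  · intro k hk
    rw [hF k hk, hO]
    exact minim hφ hp (VV_meas hfm) (VV_nonneg f) hl hR
      (fun k => rho γ (conj φ) w (fun t => p (k * |f t|)))
      (fun a b ha hab => A_low hw hφ hp hfm ha hab)
      (fun a b ha hab => A_up hw hφ hp hfm ha hab) hk

end OL
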